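/- Let G be the subgroup of O(Λ_ℚ) generated by Γ and O(L_ℚ). Let λ ∈ L_ℚ and t ∈ ℚ, and assume that (λ,λ) ≠ 0. Then there exists an isometry g ∈ G such that g(λ + tδ) belongs to L_ℚ. -/

import Mathlib

noncomputable section

open LinearMap (BilinForm)

variable {V : Type*} [AddCommGroup V] [Module ℚ V]

/-- The group `O(B)` of isometries of a bilinear form `B`. -/
def isomGroup (B : BilinForm ℚ V) : Subgroup (V ≃ₗ[ℚ] V) where
  carrier := {g | ∀ x y, B (g x) (g y) = B x y}
  one_mem' := fun _ _ => rfl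
  mul_mem' := by
    intro a b ha hb x y
    calc B ((a * b) x) ((a * b) y) = B (a (b x)) (a (b y)) := rfl
      _ = B (b x) (b y) := ha _ _
      _ = B x y := hb _ _
  inv_mem' := by
    intro a ha x y
    calc B (a⁻¹ x) (a⁻¹ y) = B (a (a⁻¹ x)) (a (a⁻¹ y)) := (ha _ _).symm
      _ = B x y := by
          show B (a (a.symm x)) (a (a.symm y)) = B x y
          rw [a.apply_symm_apply, a.apply_symm_apply]

/-- `P` is a 3-dimensional positive-definite subspace for `B`. -/
def IsPosDefThree (B : BilinForm ℚ V) (P : Submodule ℚ V) : Prop :=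
  Module.finrank ℚ P = 3 ∧ ∀ x ∈ P, x ≠ 0 → 0 < B x x

/-- `g` preserves the orientation of the positive cone of `B`: for some 3-dimensional
positive-definite subspace `P`, the composition of the restriction of `g` to `P` with the
`B`-orthogonal projection back onto `P` has positive determinant. -/
def OrientPos (B : BilinForm ℚ V) (g : V ≃ₗ[ℚ] V) : Prop :=
  ∃ P : Submodule ℚ V, IsPosDefThree B P ∧
    ∃ π : V →ₗ[ℚ] V, (∀ x, π x ∈ P) ∧ (∀ x, ∀ p ∈ P, B (x - π x) p = 0) ∧
      ∃ q : ↥P →ₗ[ℚ] ↥P, (∀ x : ↥P, (q x : V) = π (g (x : V))) ∧ 0 < LinearMap.det q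

/-- The dual lattice `L* = {x : (x, L) ⊆ ℤ}` of a lattice `L`. -/
def dualLattice (B : BilinForm ℚ V) (L : Submodule ℤ V) : Submodule ℤ V where
  carrier := {x | ∀ y ∈ L, ∃ n : ℤ, B x y = (n : ℚ)}
  zero_mem' := by
    intro y _
    exact ⟨0, by simp⟩
  add_mem' := by
    intro a b ha hb y hy
    obtain ⟨m, hm⟩ := ha y hy
    obtain ⟨n, hn⟩ := hb y hy
    refine ⟨m + n, ?_⟩
    rw [map_add, LinearMap.add_apply, hm, hn]
    push_cast
    ring
  smul_mem' := by
    intro c x hx y hy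
    obtain ⟨n, hn⟩ := hx y hy
    refine ⟨c * n, ?_⟩
    have h1 : ((c : ℚ)) • x = c • x := Int.cast_smul_eq_zsmul ℚ c x
    rw [← h1, map_smul, LinearMap.smul_apply, hn, smul_eq_mul]
    push_cast
    ring

/-- `g` maps the lattice `L` bijectively onto itself. -/
def PreservesLattice (L : Submodule ℤ V) (g : V ≃ₗ[ℚ] V) : Prop :=
  (∀ x ∈ L, g x ∈ L) ∧ ∀ x ∈ L, g.symm x ∈ L

/-- `g` acts on the discriminant group `L*/L` as `+1` or as `-1`. -/
def ActsAsPMOne (B : BilinForm ℚ V) (L : Submodule ℤ V) (g : V ≃ₗ[ℚ] V) : Prop :=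
  (∀ x ∈ dualLattice B L, g x - x ∈ L) ∨ ∀ x ∈ dualLattice B L, g x + x ∈ L

/-- Membership in the subgroup `Γ ⊆ O⁺(Λ)` of isometries preserving the lattice and acting
on the discriminant group as `±1`. -/
def InGamma (B : BilinForm ℚ V) (L : Submodule ℤ V) (g : V ≃ₗ[ℚ] V) : Prop :=
  g ∈ isomGroup B ∧ PreservesLattice L g ∧ OrientPos B g ∧ ActsAsPMOne B L g

/-- The bilinear form of `Λ_ℚ = L_ℚ ⊕ ℚδ` with `(δ, δ) = -2d`. -/
def prodForm (B : BilinForm ℚ V) (d : ℤ) : BilinForm ℚ (V × ℚ) :=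
  LinearMap.mk₂ ℚ (fun p q => B p.1 q.1 - (2 * (d : ℚ)) * (p.2 * q.2))
    (fun p p' q => by
      simp only [Prod.fst_add, Prod.snd_add, map_add, LinearMap.add_apply]
      ring)
    (fun c p q => by
      simp only [Prod.smul_fst, Prod.smul_snd, map_smul, LinearMap.smul_apply, smul_eq_mul]
      ring)
    (fun p q q' => by
      simp only [Prod.fst_add, Prod.snd_add, map_add, LinearMap.add_apply]
      ring)
    (fun p c q => by
      simp only [Prod.smul_fst, Prod.smul_snd, map_smul, LinearMap.smul_apply, smul_eq_mul]
      ring)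

/-- The lattice `ℤ ⊆ ℚ`, i.e. the ℤ-span of `1`. -/
def intLat : Submodule ℤ ℚ := Submodule.span ℤ {(1 : ℚ)}

/-- Membership in the subgroup `O(L_ℚ) ⊆ O(Λ_ℚ)`: isometries of `Λ_ℚ = L_ℚ ⊕ ℚδ` preserving
`L_ℚ` and fixing `δ`, i.e. extensions of isometries of `L_ℚ` by the identity on `δ`. -/
def InOLQ (B : BilinForm ℚ V) (d : ℤ) (g : (V × ℚ) ≃ₗ[ℚ] (V × ℚ)) : Prop :=
  g ∈ isomGroup (prodForm B d) ∧ (∀ x : V, (g (x, 0)).2 = 0) ∧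
    g ((0 : V), (1 : ℚ)) = ((0 : V), (1 : ℚ))

/-- `B` has signature `(3, s)`: an orthogonal direct sum decomposition into a positive-definite
subspace of dimension `3` and a negative-definite subspace of dimension `s`. -/
def HasSignatureThree (B : BilinForm ℚ V) (s : ℕ) : Prop :=
  ∃ P N : Submodule ℚ V, IsCompl P N ∧ (∀ x ∈ P, ∀ y ∈ N, B x y = 0) ∧
    Module.finrank ℚ P = 3 ∧ Module.finrank ℚ N = s ∧
    (∀ x ∈ P, x ≠ 0 → 0 < B x x) ∧ ∀ x ∈ N, x ≠ 0 → B x x < 0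

/-- `L` contains a sublattice isometric to `U ⊕ U ⊕ U`, where `U` is the hyperbolic plane with
isotropic basis `e, f` and `(e, f) = -1`. -/
def ContainsU3 (B : BilinForm ℚ V) (L : Submodule ℤ V) : Prop :=
  ∃ e f : Fin 3 → V, (∀ i, e i ∈ L) ∧ (∀ i, f i ∈ L) ∧
    (∀ i j, B (e i) (e j) = 0) ∧ (∀ i j, B (f i) (f j) = 0) ∧
    ∀ i j, B (e i) (f j) = if i = j then -1 else 0

/-- `l` is a primitive element of the lattice `L`: `l ∈ L`, `l ≠ 0` and `L/ℤl` is
torsion-free. -/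
def IsPrimitiveIn (L : Submodule ℤ V) (l : V) : Prop :=
  l ∈ L ∧ l ≠ 0 ∧ ∀ y ∈ L, ∀ n : ℤ, n ≠ 0 →
    n • y ∈ Submodule.span ℤ ({l} : Set V) → y ∈ Submodule.span ℤ ({l} : Set V)

/-- The reflection `ρ_u(x) = x - (2(u,x)/(u,u))·u` (as a plain function). -/
def reflFun (B : BilinForm ℚ V) (u : V) (x : V) : V :=
  x - (2 * B u x / B u u) • u

lemma prodForm_apply (B : BilinForm ℚ V) (d : ℤ) (p q : V × ℚ) :
    prodForm B d p q = B p.1 q.1 - 2 * (d : ℚ) * (p.2 * q.2) := rfl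

lemma mem_intLat {s : ℚ} : s ∈ intLat ↔ ∃ n : ℤ, s = n := by
  simp [intLat, Submodule.mem_span_singleton, eq_comm]

lemma intCast_smul_mem {L : Submodule ℤ V} {x : V} (hx : x ∈ L) {r : ℚ} (n : ℤ) (hr : r = n) :
    r • x ∈ L := by
  rw [hr, Int.cast_smul_eq_zsmul]
  exact L.smul_mem n hx

/-- The reflection of `V` in the vector `u`, extended by the identity on `δ`. -/
def prodRefl (B : BilinForm ℚ V) (u : V) (hu : B u u ≠ 0) : (V × ℚ) ≃ₗ[ℚ] (V × ℚ) :=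
  LinearEquiv.ofInvolutive
    { toFun := fun p => (reflFun B u p.1, p.2)
      map_add' := fun p q => by
        ext
        · simp only [reflFun, Prod.fst_add, map_add]
          module
        · rfl
      map_smul' := fun c p => by
        ext
        · simp only [reflFun, Prod.smul_fst, map_smul, smul_eq_mul, RingHom.id_apply]
          module
        · rfl }
    (fun p => by
      ext
      · simp only [LinearMap.coe_mk, AddHom.coe_mk, reflFun, map_sub, map_smul, smul_eq_mul]
        rw [div_mul_cancel₀ _ hu, sub_sub, ← add_smul, sub_eq_self]
        convert zero_smul ℚ u using 2
        field_simp
        ring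
      · rfl)

lemma prodRefl_apply (B : BilinForm ℚ V) (u : V) (hu : B u u ≠ 0) (p : V × ℚ) :
    prodRefl B u hu p = (reflFun B u p.1, p.2) := rfl

lemma prodRefl_inOLQ (B : BilinForm ℚ V) (hsymm : ∀ x y, B x y = B y x) (d : ℤ) (u : V)
    (hu : B u u ≠ 0) : InOLQ B d (prodRefl B u hu) := by
  refine ⟨fun p q => ?_, fun x => rfl, ?_⟩
  · simp only [prodRefl_apply, prodForm_apply, reflFun, map_sub, map_smul, LinearMap.sub_apply,
      LinearMap.smul_apply, smul_eq_mul, hsymm p.1 u]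
    field_simp
    ring
  · simp [prodRefl_apply, reflFun]

/-- A reflection carries `x` to `y` when both have the same norm and `x - y` is anisotropic. -/
lemma reflFun_sub (B : BilinForm ℚ V) (hsymm : ∀ x y, B x y = B y x) {x y : V}
    (h : B x x = B y y) (hu : B (x - y) (x - y) ≠ 0) : reflFun B (x - y) x = y := by
  have hnum : 2 * B (x - y) x = B (x - y) (x - y) := by
    simp only [map_sub, LinearMap.sub_apply, h, hsymm y x]
    ring
  rw [reflFun, hnum, div_self hu, one_smul, sub_sub_cancel]

/-- The linear map underlying the Eichler transvection of `Λ_ℚ` attached to the isotropic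
vector `e ∈ L_ℚ` and to `cδ`. -/
def eichlerMap (B : BilinForm ℚ V) (d : ℤ) (e : V) (c : ℤ) : (V × ℚ) →ₗ[ℚ] (V × ℚ) where
  toFun p := (p.1 + (2 * d * c * p.2 + d * c ^ 2 * B e p.1) • e, p.2 + c * B e p.1)
  map_add' p q := by
    ext
    · simp only [Prod.fst_add, Prod.snd_add, map_add]
      module
    · simp only [Prod.fst_add, Prod.snd_add, map_add]
      ring
  map_smul' r p := by
    ext
    · simp only [Prod.smul_fst, Prod.smul_snd, map_smul, smul_eq_mul, RingHom.id_apply]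
      module
    · simp only [Prod.smul_fst, Prod.smul_snd, map_smul, smul_eq_mul, RingHom.id_apply]
      ring

lemma eichlerMap_apply (B : BilinForm ℚ V) (d : ℤ) (e : V) (c : ℤ) (p : V × ℚ) :
    eichlerMap B d e c p =
      (p.1 + (2 * d * c * p.2 + d * c ^ 2 * B e p.1) • e, p.2 + c * B e p.1) := rfl

lemma eichlerMap_neg_eichlerMap (B : BilinForm ℚ V) (d : ℤ) {e : V} (he : B e e = 0) (c : ℤ)
    (p : V × ℚ) : eichlerMap B d e (-c) (eichlerMap B d e c p) = p := by
  ext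
  · simp only [eichlerMap_apply, map_add, map_smul, he, smul_eq_mul]
    push_cast
    module
  · simp only [eichlerMap_apply, map_add, map_smul, he, smul_eq_mul]
    push_cast
    ring

/-- The Eichler transvection of `Λ_ℚ` attached to the isotropic vector `e ∈ L_ℚ` and to `cδ`. -/
def eichler (B : BilinForm ℚ V) (d : ℤ) (e : V) (he : B e e = 0) (c : ℤ) :
    (V × ℚ) ≃ₗ[ℚ] (V × ℚ) :=
  LinearEquiv.ofLinearMap (eichlerMap B d e c) (eichlerMap B d e (-c))
    (LinearMap.ext fun p => by simpa using eichlerMap_neg_eichlerMap B d he (-c) p)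
    (LinearMap.ext fun p => by simpa using eichlerMap_neg_eichlerMap B d he c p)

lemma eichler_apply (B : BilinForm ℚ V) (d : ℤ) (e : V) (he : B e e = 0) (c : ℤ) (p : V × ℚ) :
    eichler B d e he c p = eichlerMap B d e c p := rfl

lemma eichlerMap_mem (B : BilinForm ℚ V) (L : Submodule ℤ V)
    (hint : ∀ x ∈ L, ∀ y ∈ L, ∃ n : ℤ, B x y = (n : ℚ)) (d : ℤ) {e : V} (heL : e ∈ L) (c : ℤ)
    {p : V × ℚ} (hp : p ∈ L.prod intLat) : eichlerMap B d e c p ∈ L.prod intLat := by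
  obtain ⟨h1, h2⟩ := Submodule.mem_prod.mp hp
  obtain ⟨m, hm⟩ := mem_intLat.mp h2
  obtain ⟨n, hn⟩ := hint e heL p.1 h1
  rw [eichlerMap_apply, hm, hn]
  refine Submodule.mem_prod.mpr ⟨L.add_mem h1 (intCast_smul_mem heL
    (2 * d * c * m + d * c ^ 2 * n) (by push_cast; ring)), mem_intLat.mpr ⟨m + c * n, ?_⟩⟩
  push_cast
  ring

lemma eichler_mem_isomGroup (B : BilinForm ℚ V) (hsymm : ∀ x y, B x y = B y x) (d : ℤ) {e : V}
    (he : B e e = 0) (c : ℤ) : eichler B d e he c ∈ isomGroup (prodForm B d) := by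
  intro p q
  simp only [eichler_apply, eichlerMap_apply, prodForm_apply, map_add, map_smul,
    LinearMap.add_apply, LinearMap.smul_apply, smul_eq_mul, he, hsymm p.1 e]
  ring

lemma eichler_actsAsPMOne (B : BilinForm ℚ V) (L : Submodule ℤ V)
    (hint : ∀ x ∈ L, ∀ y ∈ L, ∃ n : ℤ, B x y = (n : ℚ)) (hunimod : dualLattice B L = L) (d : ℤ)
    {e : V} (heL : e ∈ L) (he : B e e = 0) (c : ℤ) :
    ActsAsPMOne (prodForm B d) (L.prod intLat) (eichler B d e he c) := by
  left
  intro p hp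
  have h1 : p.1 ∈ L := by
    rw [← hunimod]
    intro y hy
    obtain ⟨n, hn⟩ := hp (y, 0) (Submodule.mem_prod.mpr ⟨hy, Submodule.zero_mem _⟩)
    exact ⟨n, by simpa [prodForm_apply] using hn⟩
  obtain ⟨m, hm⟩ := hp (0, 1)
    (Submodule.mem_prod.mpr ⟨Submodule.zero_mem _, mem_intLat.mpr ⟨1, by simp⟩⟩)
  have hm' : 2 * (d : ℚ) * p.2 = -m := by
    simp only [prodForm_apply, map_zero, mul_one] at hm
    linarith
  obtain ⟨n, hn⟩ := hint e heL p.1 h1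
  rw [eichler_apply, eichlerMap_apply]
  refine Submodule.mem_prod.mpr ⟨?_, mem_intLat.mpr ⟨c * n, ?_⟩⟩
  · rw [Prod.fst_sub, add_sub_cancel_left]
    refine intCast_smul_mem heL (-m * c + d * c ^ 2 * n) ?_
    rw [hn]
    push_cast
    linear_combination (c : ℚ) * hm'
  · simp [hn]

/-- Orientation-preservation may be checked on an orthogonal basis of a positive-definite
3-space, when `g` acts on it, up to orthogonal projection, by positive scalars. -/
lemma orientPos_of_diagonal (B : BilinForm ℚ V) (g : V ≃ₗ[ℚ] V) (p : Fin 3 → V) (a : Fin 3 → ℚ)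
    (ha : ∀ i, 0 < a i) (hp : ∀ i j, B (p i) (p j) = if i = j then 2 else 0)
    (hg : ∀ i j, B (g (p i)) (p j) = if i = j then 2 * a i else 0) : OrientPos B g := by
  let π : V →ₗ[ℚ] V := ∑ i, ((1 / 2 : ℚ) • B.flip (p i)).smulRight (p i)
  have hπ : ∀ x, π x = ∑ i, (1 / 2 * B x (p i)) • p i := fun x => by
    simp [π, LinearMap.sum_apply]
  have hli : LinearIndependent ℚ p := by
    rw [Fintype.linearIndependent_iff]
    intro c hc j
    have h := congrArg (fun x => B x (p j)) hc
    simpa [map_sum, LinearMap.sum_apply, hp] using h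
  let b := Module.Basis.span hli
  have hb : ∀ i, (b i : V) = p i := fun i =>
    congrArg Subtype.val (Module.Basis.span_apply hli i)
  refine ⟨Submodule.span ℚ (Set.range p), ⟨?_, fun x hx hx0 => ?_⟩, π, fun x => ?_,
    fun x y hy => ?_, Matrix.toLin b b (Matrix.diagonal a), fun x => ?_, ?_⟩
  · simpa using finrank_span_eq_card hli
  · obtain ⟨c, rfl⟩ := (Submodule.mem_span_range_iff_exists_fun ℚ).mp hx
    have hc : c ≠ 0 := by
      rintro rfl
      simp at hx0
    obtain ⟨k, hk⟩ := Function.ne_iff.mp hc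
    have hsum : B (∑ i, c i • p i) (∑ i, c i • p i) = ∑ i, 2 * c i ^ 2 := by
      simp only [map_sum, map_smul, LinearMap.sum_apply, LinearMap.smul_apply, hp, smul_eq_mul,
        mul_ite, mul_zero, Finset.sum_ite_eq', Finset.mem_univ, if_true]
      exact Finset.sum_congr rfl fun i _ => by ring
    rw [hsum]
    refine Finset.sum_pos' (fun i _ => by positivity) ⟨k, Finset.mem_univ k, ?_⟩
    have : c k ≠ 0 := hk
    positivity
  · rw [hπ]
    exact Submodule.sum_mem _ fun i _ =>
      Submodule.smul_mem _ _ (Submodule.subset_span ⟨i, rfl⟩)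
  · induction hy using Submodule.span_induction with
    | mem y hy =>
      obtain ⟨j, rfl⟩ := hy
      simp only [hπ, map_sub, map_sum, map_smul, LinearMap.sub_apply, LinearMap.sum_apply,
        LinearMap.smul_apply, hp, smul_eq_mul, mul_ite, mul_zero, Finset.sum_ite_eq',
        Finset.mem_univ, if_true]
      ring
    | zero => simp
    | add y z _ _ hy hz => rw [map_add, hy, hz, add_zero]
    | smul r y _ hy => rw [map_smul, hy, smul_zero]
  · suffices h : (Submodule.subtype _).comp (Matrix.toLin b b (Matrix.diagonal a)) =
        (π.comp g.toLinearMap).comp (Submodule.subtype _) from LinearMap.congr_fun h x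
    refine b.ext fun i => ?_
    simp [Matrix.toLin_self, Matrix.diagonal_apply, hb, hπ, hg]
  · rw [LinearMap.det_toLin, Matrix.det_diagonal]
    exact Finset.prod_pos fun i _ => ha i

lemma eichler_orientPos (B : BilinForm ℚ V) (hsymm : ∀ x y, B x y = B y x) {d : ℤ} (hd : 0 < d)
    {e f : Fin 3 → V} (hee : ∀ i j, B (e i) (e j) = 0) (hff : ∀ i j, B (f i) (f j) = 0)
    (hef : ∀ i j, B (e i) (f j) = if i = j then -1 else 0) (k : Fin 3) (c : ℤ) :
    OrientPos (prodForm B d) (eichler B d (e k) (hee k k) c) := by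
  have hd' : (0 : ℚ) < d := by exact_mod_cast hd
  have hfe : ∀ i j, B (f i) (e j) = if i = j then -1 else 0 := fun i j => by
    rw [hsymm, hef]
    simp only [eq_comm]
  refine orientPos_of_diagonal _ _ (fun i => (e i - f i, 0))
    (fun i => if i = k then 1 + d * c ^ 2 / 2 else 1) (fun i => ?_) (fun i j => ?_) fun i j => ?_
  · split_ifs <;> positivity
  · simp only [prodForm_apply, map_sub, LinearMap.sub_apply, hee, hff, hef, hfe]
    split_ifs <;> norm_num
  · simp only [eichler_apply, eichlerMap_apply, prodForm_apply, map_add, map_sub, map_smul,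
      LinearMap.add_apply, LinearMap.sub_apply, LinearMap.smul_apply, smul_eq_mul, hee, hff, hef,
      hfe]
    split_ifs <;> first | (exfalso; lia) | ring

lemma eichler_inGamma (B : BilinForm ℚ V) (L : Submodule ℤ V) (hsymm : ∀ x y, B x y = B y x)
    (hint : ∀ x ∈ L, ∀ y ∈ L, ∃ n : ℤ, B x y = (n : ℚ)) (hunimod : dualLattice B L = L)
    {d : ℤ} (hd : 0 < d) {e f : Fin 3 → V} (heL : ∀ i, e i ∈ L)
    (hee : ∀ i j, B (e i) (e j) = 0) (hff : ∀ i j, B (f i) (f j) = 0)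
    (hef : ∀ i j, B (e i) (f j) = if i = j then -1 else 0) (k : Fin 3) (c : ℤ) :
    InGamma (prodForm B d) (L.prod intLat) (eichler B d (e k) (hee k k) c) :=
  ⟨eichler_mem_isomGroup B hsymm d (hee k k) c,
    ⟨fun _ hx => eichlerMap_mem B L hint d (heL k) c hx,
      fun _ hx => eichlerMap_mem B L hint d (heL k) (-c) hx⟩,
    eichler_orientPos B hsymm hd hee hff hef k c,
    eichler_actsAsPMOne B L hint hunimod d (heL k) (hee k k) c⟩

/-- Let `G` be the subgroup of `O(Λ_ℚ)` generated by `Γ` and `O(L_ℚ)`.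
Let `λ ∈ L_ℚ` and `t ∈ ℚ` with `(λ,λ) ≠ 0`. Then there is `g ∈ G` with
`g(λ + tδ) ∈ L_ℚ`. -/
theorem statement2
    {V : Type*} [AddCommGroup V] [Module ℚ V] [FiniteDimensional ℚ V]
    (B : BilinForm ℚ V) (L : Submodule ℤ V) (d : ℤ)
    (hsymm : ∀ x y, B x y = B y x)
    (hfull : Submodule.span ℚ (L : Set V) = ⊤)
    (hfg : L.FG)
    (hint : ∀ x ∈ L, ∀ y ∈ L, ∃ n : ℤ, B x y = (n : ℚ))
    (heven : ∀ x ∈ L, ∃ n : ℤ, B x x = 2 * (n : ℚ))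
    (hunimod : dualLattice B L = L)
    (sminus : ℕ) (hs : 3 ≤ sminus) (hsig : HasSignatureThree B sminus)
    (hU3 : ContainsU3 B L)
    (hd : 0 < d)
    (lam : V) (t : ℚ) (hlam : B lam lam ≠ 0) :
    ∃ g ∈ Subgroup.closure {g : (V × ℚ) ≃ₗ[ℚ] (V × ℚ) |
        InGamma (prodForm B d) (L.prod intLat) g ∨ InOLQ B d g},
      (g ((lam, t) : V × ℚ)).2 = 0 := by
  obtain ⟨e, f, heL, -, hee, hff, hef⟩ := hU3
  by_cases ht : t = 0
  · exact ⟨1, Subgroup.one_mem _, ht⟩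
  suffices h : ∀ (c : ℤ) (μ : V), B lam lam = B μ μ → t + c * B (e 0) μ = 0 →
      B (lam - μ) (lam - μ) ≠ 0 → ∃ g ∈ Subgroup.closure {g : (V × ℚ) ≃ₗ[ℚ] (V × ℚ) |
        InGamma (prodForm B d) (L.prod intLat) g ∨ InOLQ B d g},
      (g ((lam, t) : V × ℚ)).2 = 0 by
    have hef0 : B (e 0) (f 0) = -1 := by simp [hef]
    have hfe0 : B (f 0) (e 0) = -1 := by rw [hsymm, hef0]
    set μ : V := t • f 0 - (B lam lam / (2 * t)) • e 0 with hμ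
    have hμμ : B lam lam = B μ μ := by
      simp only [hμ, map_sub, map_smul, LinearMap.sub_apply, LinearMap.smul_apply, smul_eq_mul,
        hee, hff, hef0, hfe0]
      field_simp
      ring
    have heμ : B (e 0) μ = -t := by
      simp [hμ, hee, hef0]
    by_cases hu : B (lam - μ) (lam - μ) = 0
    · refine h (-1) (-μ) (by simpa using hμμ) (by simp [heμ]) fun hu' => hlam ?_
      simp only [sub_neg_eq_add, map_sub, map_add, LinearMap.sub_apply,
        LinearMap.add_apply] at hu hu'
      linarith
    · exact h 1 μ hμμ (by simp [heμ]) hu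
  intro c μ hμ hc hu
  refine ⟨eichler B d (e 0) (hee 0 0) c * prodRefl B (lam - μ) hu,
    Subgroup.mul_mem _
      (Subgroup.subset_closure
        (Or.inl (eichler_inGamma B L hsymm hint hunimod hd heL hee hff hef 0 c)))
      (Subgroup.subset_closure (Or.inr (prodRefl_inOLQ B hsymm d (lam - μ) hu))), ?_⟩
  rw [LinearEquiv.mul_apply, prodRefl_apply, reflFun_sub B hsymm hμ hu]
  exact hc
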